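/- arXiv:2510.02900 — 2 statements merged into one kernel-verified Lean document; each statement's English description precedes it below -/
import Mathlib

section
/- Suppose the set {(λ,μ) ∈ ℂ × ℂ : det(M(λ,μ)) = 0 and trace(S(μ) * adjugate(M(λ,μ))) = 0} is finite. Then the set of eigenvalues of the NEPv, namely {λ ∈ ℂ : ∃ v ≠ 0, A *ᵥ v = λ·(B *ᵥ v) + ((v*Pv)/(v*Qv))·(C *ᵥ v)}, is finite with cardinality at most n². -/
open Matrix
open scoped ComplexOrder
open Polynomial

theorem natDegree_det_le_sum_sub_sum {R ι : Type*} [CommRing R] [Fintype ι] [DecidableEq ι]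
    {M : Matrix ι ι R[X]} {u w : ι → ℕ} (h : ∀ i j, M i j ≠ 0 → (M i j).natDegree + u i ≤ w j) :
    M.det.natDegree ≤ ∑ j, w j - ∑ i, u i := by
  rw [Matrix.det_apply]
  refine natDegree_sum_le_of_forall_le _ _ fun σ _ ↦ (natDegree_smul_le _ _).trans ?_
  by_cases h0 : ∃ i, M (σ i) i = 0
  · obtain ⟨i, hi⟩ := h0
    have hprod := Finset.prod_eq_zero (f := fun i ↦ M (σ i) i) (Finset.mem_univ i) hi
    exact (congrArg natDegree hprod).le.trans (by simp)
  push Not at h0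
  have h1 := Finset.sum_le_sum fun i (_ : i ∈ Finset.univ) ↦ h (σ i) i (h0 i)
  rw [Finset.sum_add_distrib, Equiv.sum_comp σ u] at h1
  have h2 := natDegree_prod_le Finset.univ fun i ↦ M (σ i) i
  lia

/-- The bivariate polynomial `p` has total degree at most `d`. -/
def TotalDegreeLE {R : Type*} [Semiring R] (d : ℕ) (p : R[X][X]) : Prop :=
  ∀ k j, d < j + k → (p.coeff k).coeff j = 0

namespace TotalDegreeLE

section Semiring

variable {R : Type*} [Semiring R] {d e : ℕ} {p q : R[X][X]}

theorem natDegree_le (hp : TotalDegreeLE d p) : p.natDegree ≤ d :=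
  natDegree_le_iff_coeff_eq_zero.2 fun k hk ↦ by
    ext j
    simpa using hp k j (by lia)

theorem natDegree_coeff_add_le (hp : TotalDegreeLE d p) {k : ℕ} (hk : p.coeff k ≠ 0) :
    (p.coeff k).natDegree + k ≤ d := by
  by_contra! h
  exact hk (leadingCoeff_eq_zero.1 (hp k _ h))

theorem mul (hp : TotalDegreeLE d p) (hq : TotalDegreeLE e q) :
    TotalDegreeLE (d + e) (p * q) := by
  intro k j h
  rw [coeff_mul, finsetSum_coeff]
  refine Finset.sum_eq_zero fun x hx ↦ ?_
  rw [coeff_mul]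
  refine Finset.sum_eq_zero fun y hy ↦ ?_
  have hx' := Finset.HasAntidiagonal.mem_antidiagonal.1 hx
  have hy' := Finset.HasAntidiagonal.mem_antidiagonal.1 hy
  by_cases h' : d < y.1 + x.1
  · rw [hp _ _ h', zero_mul]
  · rw [hq _ _ (by lia), mul_zero]

theorem sum {ι : Type*} {s : Finset ι} {f : ι → R[X][X]}
    (h : ∀ i ∈ s, TotalDegreeLE d (f i)) : TotalDegreeLE d (∑ i ∈ s, f i) := by
  intro k j hkj
  simp only [finsetSum_coeff]
  exact Finset.sum_eq_zero fun i hi ↦ h i hi k j hkj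

end Semiring

section CommRing

variable {R : Type*} [CommRing R] {ι : Type*}

theorem prod {s : Finset ι} {f : ι → R[X][X]}
    (h : ∀ i ∈ s, TotalDegreeLE 1 (f i)) : TotalDegreeLE s.card (∏ i ∈ s, f i) := by
  classical
  induction s using Finset.induction_on with
  | empty =>
    intro k j hkj
    simp only [Finset.prod_empty, coeff_one]
    split_ifs with hk
    · rw [coeff_one, if_neg (by simp at hkj; lia)]
    · simp
  | insert a s ha ih =>
    rw [Finset.prod_insert ha, Finset.card_insert_of_notMem ha, add_comm]
    exact (h a (by simp)).mul (ih fun i hi ↦ h i (by simp [hi]))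

theorem det [Fintype ι] [DecidableEq ι] {M : Matrix ι ι R[X][X]}
    (h : ∀ i j, TotalDegreeLE 1 (M i j)) : TotalDegreeLE (Fintype.card ι) M.det := by
  rw [Matrix.det_apply]
  refine sum fun σ _ k j hkj ↦ ?_
  have := prod (s := Finset.univ) (fun i _ ↦ h (σ i) i) k j hkj
  rcases Int.units_eq_one_or (Equiv.Perm.sign σ) with hs | hs <;> simp [hs, this]

theorem trace_mul_adjugate [Fintype ι] [DecidableEq ι] {S M : Matrix ι ι R[X][X]}
    (hS : ∀ i j, TotalDegreeLE 1 (S i j)) (hM : ∀ i j, TotalDegreeLE 1 (M i j)) :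
    TotalDegreeLE (Fintype.card ι) (S * M.adjugate).trace := by
  have key (i : ι) : (S * M.adjugate) i i = (M.updateRow i (S i)).det := by
    rw [Matrix.det_eq_sum_mul_adjugate_row _ i, Matrix.mul_apply]
    simp [Matrix.adjugate_apply]
  rw [Matrix.trace]
  refine sum fun i _ ↦ ?_
  rw [Matrix.diag_apply, key]
  refine det fun k j ↦ ?_
  rw [Matrix.updateRow_apply]
  split_ifs
  exacts [hS _ _, hM _ _]

theorem natDegree_resultant_le {f g : R[X][X]} {m n : ℕ}
    (hf : TotalDegreeLE m f) (hg : TotalDegreeLE n g) :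
    (resultant f g m n).natDegree ≤ m * n := by
  let w : Fin (m + n) → ℕ := Fin.addCases (fun j ↦ (j : ℕ) + n) (fun j ↦ m + (j : ℕ))
  have hw : ∑ j, w j = ∑ j : Fin (m + n), (j : ℕ) + m * n := by
    simp [w, Fin.sum_univ_add, Finset.sum_add_distrib]
    ring
  have hentry (i j) (h : sylvester f g m n i j ≠ 0) :
      (sylvester f g m n i j).natDegree + i ≤ w j := by
    induction j using Fin.addCases with
    | left j =>
      simp only [sylvester, Matrix.of_apply, Fin.addCases_left, Set.mem_Icc, w] at h ⊢
      split_ifs at h ⊢ with hi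
      · have := hg.natDegree_coeff_add_le h
        lia
      · exact absurd rfl h
    | right j =>
      simp only [sylvester, Matrix.of_apply, Fin.addCases_right, Set.mem_Icc, w] at h ⊢
      split_ifs at h ⊢ with hi
      · have := hf.natDegree_coeff_add_le h
        lia
      · exact absurd rfl h
  have := natDegree_det_le_sum_sub_sum (u := fun i : Fin (m + n) ↦ (i : ℕ)) hentry
  rw [hw] at this
  rw [resultant]
  lia

end CommRing

end TotalDegreeLE

section Bezout

variable {K : Type*} [Field K] [IsAlgClosed K]

theorem resultant_eq_zero_iff_exists_root {f g : K[X]} {m n : ℕ} (hf : f.natDegree = m)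
    (hf0 : f ≠ 0) (hg : g.natDegree ≤ n) :
    resultant f g m n = 0 ↔ ∃ x, f.eval x = 0 ∧ g.eval x = 0 := by
  subst hf
  rw [resultant_eq_prod_eval f g n hg (IsAlgClosed.splits f)]
  simp [hf0, Multiset.prod_eq_zero_iff]

/-- Bézout's bound on the number of distinct second coordinates of the common zeros of two plane
curves without common component, the first of which has no point at infinity on the axis of the
first coordinate. -/
theorem ncard_image_snd_zeros_le {f g : K[X][X]} {m n : ℕ}
    (hf : TotalDegreeLE m f) (hg : TotalDegreeLE n g) {c : K} (hc : c ≠ 0)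
    (hfc : f.coeff m = C c) {Z : Set (K × K)} (hZ : Z.Finite)
    (hmem : ∀ x y, (x, y) ∈ Z ↔
      (f.map (evalRingHom y)).eval x = 0 ∧ (g.map (evalRingHom y)).eval x = 0) :
    (Prod.snd '' Z).ncard ≤ m * n := by
  have hroot (y : K) : (resultant f g m n).eval y = 0 ↔ ∃ x, (x, y) ∈ Z := by
    have hcoeff : (f.map (evalRingHom y)).coeff m = c := by simp [hfc]
    have hdeg : (f.map (evalRingHom y)).natDegree = m :=
      natDegree_eq_of_le_of_coeff_ne_zero (natDegree_map_le.trans hf.natDegree_le)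
        (by rwa [hcoeff])
    have hne : f.map (evalRingHom y) ≠ 0 := fun h ↦ hc (by simpa [h] using hcoeff.symm)
    rw [← coe_evalRingHom, ← resultant_map_map,
      resultant_eq_zero_iff_exists_root hdeg hne (natDegree_map_le.trans hg.natDegree_le)]
    simp [hmem]
  have himage : Prod.snd '' Z = {y | (resultant f g m n).eval y = 0} := by
    ext y
    simp [hroot]
  have hres : resultant f g m n ≠ 0 := by
    intro h
    have := hZ.image Prod.snd
    rw [himage, h] at this
    simp [Set.infinite_univ.not_finite] at this
  classical
  have hsub : (Prod.snd '' Z) = ((resultant f g m n).roots.toFinset : Set K) := by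
    rw [himage]
    ext y
    simp [hres]
  rw [hsub, Set.ncard_coe_finset]
  exact (Multiset.toFinset_card_le _).trans
    ((card_roots' _).trans (hf.natDegree_resultant_le hg))

end Bezout

section Pencil

variable {ι K : Type*}

/-- The matrix of bivariate polynomials `A + x B + y C`, where `x` is the outer variable and `y` is
the inner one. -/
noncomputable def matrixPencil [CommRing K] (A B C : Matrix ι ι K) : Matrix ι ι K[X][X] :=
  (X : K[X][X]) • (B.map Polynomial.C).map Polynomial.C +
    (A.map Polynomial.C + (X : K[X]) • C.map Polynomial.C).map Polynomial.C

theorem totalDegreeLE_matrixPencil_apply [CommRing K] (A B C : Matrix ι ι K) (i j : ι) :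
    TotalDegreeLE 1 (matrixPencil A B C i j) := by
  intro k l h
  rcases k with _ | _ | k <;> rcases l with _ | _ | l <;>
    simp_all [matrixPencil, coeff_X, coeff_C]

theorem map_eval_matrixPencil [CommRing K] [Fintype ι] [DecidableEq ι] (A B C : Matrix ι ι K)
    (x y : K) :
    ((evalRingHom x).comp (mapRingHom (evalRingHom y))).mapMatrix (matrixPencil A B C) =
      A + x • B + y • C := by
  ext i j
  simp [matrixPencil]
  ring

variable [Fintype ι] [DecidableEq ι] [Field K]

theorem ncard_image_snd_pencil_zeros_le [IsAlgClosed K] (A B C P Q R : Matrix ι ι K) (hB : B.det ≠ 0)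
    (hZ : {z : K × K | (A + z.1 • B + z.2 • C).det = 0 ∧
      ((P + z.1 • Q + z.2 • R) * (A + z.1 • B + z.2 • C).adjugate).trace = 0}.Finite) :
    (Prod.snd '' {z : K × K | (A + z.1 • B + z.2 • C).det = 0 ∧
      ((P + z.1 • Q + z.2 • R) * (A + z.1 • B + z.2 • C).adjugate).trace = 0}).ncard ≤
        Fintype.card ι ^ 2 := by
  rw [sq]
  have hM := totalDegreeLE_matrixPencil_apply A B C
  refine ncard_image_snd_zeros_le (TotalDegreeLE.det hM)
    (TotalDegreeLE.trace_mul_adjugate (totalDegreeLE_matrixPencil_apply P Q R) hM) hB ?_ hZ ?_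
  · rw [matrixPencil, coeff_det_X_add_C_card]
    exact (RingHom.map_det Polynomial.C B).symm
  · intro x y
    let φ := (evalRingHom x).comp (mapRingHom (evalRingHom y))
    change _ ↔ φ (matrixPencil A B C).det = 0 ∧
      φ (matrixPencil P Q R * (matrixPencil A B C).adjugate).trace = 0
    have htr (N : Matrix ι ι K[X][X]) : φ N.trace = (φ.mapMatrix N).trace := by
      simp [Matrix.trace]
    rw [htr, map_mul, RingHom.map_adjugate, RingHom.map_det, map_eval_matrixPencil,
      map_eval_matrixPencil]
    rfl

/-- For all but finitely many `t`, the map `(x, y) ↦ y - t x` is injective on a finite set. -/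
theorem finite_setOf_not_injOn_sub_mul {Z : Set (K × K)} (hZ : Z.Finite) :
    {t : K | ¬ Set.InjOn (fun z : K × K ↦ z.2 - t * z.1) Z}.Finite := by
  refine ((hZ.prod hZ).image fun w ↦ (w.1.2 - w.2.2) / (w.1.1 - w.2.1)).subset fun t ht ↦ ?_
  simp only [Set.InjOn, Set.mem_ofPred_eq] at ht
  push Not at ht
  obtain ⟨z, hz, w, hw, h, hne⟩ := ht
  refine ⟨(z, w), ⟨hz, hw⟩, ?_⟩
  have h1 : z.1 - w.1 ≠ 0 := fun h1 ↦ hne <| by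
    have h2 := sub_eq_zero.1 h1
    refine Prod.ext h2 ?_
    rw [h2] at h
    simpa using h
  dsimp only
  rw [div_eq_iff h1]
  linear_combination h

theorem finite_setOf_det_add_smul_eq_zero {B : Matrix ι ι K} (C : Matrix ι ι K)
    (hB : B.det ≠ 0) : {t : K | (B + t • C).det = 0}.Finite := by
  let p : K[X] := ((X : K[X]) • C.map Polynomial.C + B.map Polynomial.C).det
  have hp (t : K) : p.eval t = (B + t • C).det := by
    rw [← coe_evalRingHom, RingHom.map_det]
    congr 1
    ext i j
    simp
    ring
  have hp0 : p ≠ 0 := fun h ↦ hB (by simpa [h] using (hp 0).symm)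
  simp only [← hp]
  exact finite_setOfPred_isRoot hp0

/-- Bézout's bound for the two curves `det (A - x B - y C) = 0` and
`tr ((P - y Q) adj (A - x B - y C)) = 0`. -/
theorem ncard_pencil_zeros_le [IsAlgClosed K] (A B C P Q : Matrix ι ι K) (hB : B.det ≠ 0)
    (hZ : {p : K × K | (A - p.1 • B - p.2 • C).det = 0 ∧
      ((P - p.2 • Q) * (A - p.1 • B - p.2 • C).adjugate).trace = 0}.Finite) :
    {p : K × K | (A - p.1 • B - p.2 • C).det = 0 ∧
      ((P - p.2 • Q) * (A - p.1 • B - p.2 • C).adjugate).trace = 0}.ncard ≤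
        Fintype.card ι ^ 2 := by
  set Z := {p : K × K | (A - p.1 • B - p.2 • C).det = 0 ∧
      ((P - p.2 • Q) * (A - p.1 • B - p.2 • C).adjugate).trace = 0} with hZdef
  obtain ⟨t, ht⟩ :=
    ((finite_setOf_not_injOn_sub_mul hZ).union
      (finite_setOf_det_add_smul_eq_zero C hB)).exists_notMem
  simp only [Set.mem_union, Set.mem_ofPred_eq, not_or, not_not] at ht
  let e : K × K → K × K := fun z ↦ (z.1, z.2 - t * z.1)
  have he : {z : K × K | (A + z.1 • (-(B + t • C)) + z.2 • (-C)).det = 0 ∧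
      ((P + z.1 • (-(t • Q)) + z.2 • (-Q)) *
        (A + z.1 • (-(B + t • C)) + z.2 • (-C)).adjugate).trace = 0} = e '' Z := by
    ext ⟨x, y⟩
    have h1 : A + x • (-(B + t • C)) + y • (-C) = A - x • B - (y + t * x) • C := by
      module
    have h2 : P + x • (-(t • Q)) + y • (-Q) = P - (y + t * x) • Q := by
      module
    simp only [Set.mem_ofPred_eq, h1, h2]
    constructor
    · exact fun h ↦ ⟨(x, y + t * x), h, by simp [e]⟩
    · rintro ⟨z, hz, hze⟩
      obtain ⟨rfl, rfl⟩ := Prod.ext_iff.1 hze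
      simpa [e, hZdef] using hz
  have hdet : (-(B + t • C)).det ≠ 0 := by
    rw [Matrix.det_neg]
    exact mul_ne_zero (by simp) ht.2
  have := ncard_image_snd_pencil_zeros_le A (-(B + t • C)) (-C) P (-(t • Q)) (-Q) hdet
    (by rw [he]; exact hZ.image e)
  rw [he, Set.image_image, ht.1.ncard_image] at this
  exact this

end Pencil

/-- If `v` spans the kernel of a Hermitian matrix `M`, then `adj M` is a multiple of `v v*`; if the
kernel is larger, `adj M` vanishes. -/
theorem Matrix.IsHermitian.exists_adjugate_eq_smul_vecMulVec {ι K : Type*} [Fintype ι]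
    [DecidableEq ι] [Field K] [StarRing K] {M : Matrix ι ι K} (hM : M.IsHermitian) {v : ι → K}
    (hv : v ≠ 0) (hMv : M *ᵥ v = 0) :
    ∃ c : K, M.adjugate = c • Matrix.vecMulVec v (star v) := by
  by_cases h0 : M.adjugate = 0
  · exact ⟨0, by simp [h0]⟩
  obtain ⟨i, j, hij⟩ : ∃ i j, M.adjugate i j ≠ 0 := by
    by_contra! h
    exact h0 (Matrix.ext h)
  have hker (u : ι → K) (hu : M *ᵥ u = 0) (hui : u i = 0) : u = 0 := by
    by_contra hne
    rw [Matrix.adjugate_apply] at hij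
    refine hij (Matrix.exists_mulVec_eq_zero_iff.1 ⟨u, hne, ?_⟩)
    ext k
    by_cases hk : k = j
    · subst hk
      simp [Matrix.mulVec, hui]
    · simpa [Matrix.mulVec, hk] using congrFun hu k
  have hvi : v i ≠ 0 := fun h ↦ hv (hker v hMv h)
  have hdet : M.det = 0 := Matrix.exists_mulVec_eq_zero_iff.1 ⟨v, hv, hMv⟩
  have hcol (k l : ι) : M.adjugate k l = M.adjugate i l / v i * v k := by
    have hMl : M *ᵥ M.adjugate.col l = 0 := by
      ext m
      have := congrFun (congrFun M.mul_adjugate m) l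
      simpa [hdet, Matrix.mul_apply, Matrix.mulVec, dotProduct] using this
    have := hker (M.adjugate.col l - (M.adjugate i l / v i) • v)
      (by rw [Matrix.mulVec_sub, Matrix.mulVec_smul, hMl, hMv]; simp) (by simp [hvi])
    simpa [sub_eq_zero] using congrFun this k
  have hadj := hM.adjugate
  refine ⟨star (M.adjugate i i / v i) / v i, ?_⟩
  ext k l
  have h1 : M.adjugate i l = star (M.adjugate i i / v i) * star (v l) := by
    rw [← hadj.apply i l, hcol l i, star_mul, mul_comm]
  rw [hcol, h1]
  simp [Matrix.vecMulVec_apply]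
  ring

theorem Matrix.IsHermitian.trace_mul_adjugate_eq_zero {ι K : Type*} [Fintype ι]
    [DecidableEq ι] [Field K] [StarRing K] {M : Matrix ι ι K} (hM : M.IsHermitian)
    (S : Matrix ι ι K) {v : ι → K} (hv : v ≠ 0) (hMv : M *ᵥ v = 0)
    (hS : star v ⬝ᵥ S *ᵥ v = 0) : (S * M.adjugate).trace = 0 := by
  obtain ⟨c, hc⟩ := hM.exists_adjugate_eq_smul_vecMulVec hv hMv
  rw [hc, Matrix.mul_smul, Matrix.trace_smul, Matrix.mul_vecMulVec, Matrix.trace_vecMulVec,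
    dotProduct_comm, hS, smul_zero]

theorem Matrix.IsHermitian.star_star_dotProduct_mulVec {ι R : Type*} [Fintype ι] [CommRing R]
    [StarRing R] {A : Matrix ι ι R} (hA : A.IsHermitian) (v : ι → R) :
    star (star v ⬝ᵥ A *ᵥ v) = star v ⬝ᵥ A *ᵥ v := by
  rw [← Matrix.star_dotProduct, Matrix.star_mulVec, hA.eq, ← Matrix.dotProduct_mulVec]

theorem stmt_5 (n : ℕ) (hn : 0 < n)
    (A B C P Q : Matrix (Fin n) (Fin n) ℂ)
    (hA : A.IsHermitian) (hC : C.IsHermitian) (hP : P.IsHermitian)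
    (hB : B.PosDef) (hQ : Q.PosDef)
    (hfin : {p : ℂ × ℂ | (A - p.1 • B - p.2 • C).det = 0 ∧
      ((P - p.2 • Q) * (A - p.1 • B - p.2 • C).adjugate).trace = 0}.Finite) :
    {lam : ℂ | ∃ v : Fin n → ℂ, v ≠ 0 ∧
        A.mulVec v = lam • B.mulVec v +
          ((star v ⬝ᵥ P.mulVec v) / (star v ⬝ᵥ Q.mulVec v)) • C.mulVec v}.Finite ∧
    {lam : ℂ | ∃ v : Fin n → ℂ, v ≠ 0 ∧
        A.mulVec v = lam • B.mulVec v +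
          ((star v ⬝ᵥ P.mulVec v) / (star v ⬝ᵥ Q.mulVec v)) • C.mulVec v}.ncard ≤ n ^ 2 := by
  set Z := {p : ℂ × ℂ | (A - p.1 • B - p.2 • C).det = 0 ∧
      ((P - p.2 • Q) * (A - p.1 • B - p.2 • C).adjugate).trace = 0}
  set E := {lam : ℂ | ∃ v : Fin n → ℂ, v ≠ 0 ∧
        A.mulVec v = lam • B.mulVec v +
          ((star v ⬝ᵥ P.mulVec v) / (star v ⬝ᵥ Q.mulVec v)) • C.mulVec v}
  have hsub : E ⊆ Prod.fst '' Z := by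
    rintro lam ⟨v, hv, h⟩
    have hQv : star v ⬝ᵥ Q *ᵥ v ≠ 0 := (hQ.dotProduct_mulVec_pos hv).ne'
    have hBv : star v ⬝ᵥ B *ᵥ v ≠ 0 := (hB.dotProduct_mulVec_pos hv).ne'
    set mu := (star v ⬝ᵥ P *ᵥ v) / (star v ⬝ᵥ Q *ᵥ v) with hmu
    have hmu_star : star mu = mu := by
      rw [hmu, star_div₀, hP.star_star_dotProduct_mulVec, hQ.1.star_star_dotProduct_mulVec]
    have hlam : lam = (star v ⬝ᵥ A *ᵥ v - mu * (star v ⬝ᵥ C *ᵥ v)) / (star v ⬝ᵥ B *ᵥ v) := by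
      rw [eq_div_iff hBv, h, dotProduct_add, dotProduct_smul, dotProduct_smul]
      simp
    have hlam_star : star lam = lam := by
      rw [hlam, star_div₀, star_sub, star_mul', hmu_star, hA.star_star_dotProduct_mulVec,
        hB.1.star_star_dotProduct_mulVec, hC.star_star_dotProduct_mulVec]
    have hM : (A - lam • B - mu • C).IsHermitian := by
      rw [Matrix.IsHermitian, conjTranspose_sub, conjTranspose_sub, conjTranspose_smul,
        conjTranspose_smul, hA.eq, hB.1.eq, hC.eq, hlam_star, hmu_star]
    have hMv : (A - lam • B - mu • C) *ᵥ v = 0 := by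
      rw [sub_mulVec, sub_mulVec, smul_mulVec, smul_mulVec, h]
      abel
    refine ⟨(lam, mu), ⟨exists_mulVec_eq_zero_iff.1 ⟨v, hv, hMv⟩,
      hM.trace_mul_adjugate_eq_zero _ hv hMv ?_⟩, rfl⟩
    rw [sub_mulVec, smul_mulVec, dotProduct_sub, dotProduct_smul, smul_eq_mul, hmu,
      div_mul_cancel₀ _ hQv, sub_self]
  have hdet : B.det ≠ 0 := hB.det_pos.ne'
  refine ⟨(hfin.image _).subset hsub, ?_⟩
  calc E.ncard ≤ (Prod.fst '' Z).ncard := Set.ncard_le_ncard hsub (hfin.image _)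
    _ ≤ Z.ncard := Set.ncard_image_le hfin
    _ ≤ Fintype.card (Fin n) ^ 2 := ncard_pencil_zeros_le A B C P Q hdet hfin
    _ = n ^ 2 := by rw [Fintype.card_fin]
end

section
/- Suppose x ∈ ℂ^{n−1} is nonzero and (C*R) *ᵥ x = 0. Then the vector z = (R *ᵥ x) ⊗ (x, 0), indexed by Fin n × (Fin(n−1) ⊕ Fin n) with z(i,j) = (R *ᵥ x) i · (x,0) j, is nonzero and satisfies Δ₀ *ᵥ z = 0 and Δ₁ *ᵥ z = 0; consequently det(Δ₁ − λ·Δ₀) = 0 for every λ ∈ ℂ, i.e. the pencil (Δ₁, Δ₀) is singular. -/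
open Matrix
open scoped ComplexOrder Kronecker

/-- A Kronecker product of matrices acts factorwise on a product vector. -/
theorem kronecker_mulVec_mul {l m p q α : Type*} [Fintype m] [Fintype q] [CommSemiring α]
    (M : Matrix l m α) (N : Matrix p q α) (u : m → α) (v : q → α) :
    (M ⊗ₖ N).mulVec (fun k => u k.1 * v k.2) = fun k => M.mulVec u k.1 * N.mulVec v k.2 := by
  ext k
  simp only [mulVec, dotProduct, Fintype.sum_prod_type, Finset.sum_mul_sum]
  exact Finset.sum_congr rfl fun _ _ => Finset.sum_congr rfl fun _ _ => mul_mul_mul_comm ..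

/-- A product vector lies in the kernel of an operator determinant `M ⊗ₖ N - M' ⊗ₖ N'` when its
factors are annihilated by `M'` and `N`. -/
theorem kronecker_sub_kronecker_mulVec_mul_eq_zero {l m p q α : Type*} [Fintype m] [Fintype q]
    [CommRing α] (M M' : Matrix l m α) (N N' : Matrix p q α) {u : m → α} {v : q → α}
    (hu : M'.mulVec u = 0) (hv : N.mulVec v = 0) :
    (M ⊗ₖ N - M' ⊗ₖ N').mulVec (fun k => u k.1 * v k.2) = 0 := by
  rw [sub_mulVec, kronecker_mulVec_mul, kronecker_mulVec_mul, hu, hv]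
  ext k
  simp

theorem stmt_11 (n : ℕ) (hn : 0 < n)
    (A B C P Q : Matrix (Fin n) (Fin n) ℂ)
    (hA : A.IsHermitian) (hC : C.IsHermitian) (hP : P.IsHermitian)
    (hB : B.PosDef) (hQ : Q.PosDef)
    (R : Matrix (Fin n) (Fin (n - 1)) ℂ) (hR : Function.Injective R.mulVec)
    (Ahat : Matrix (Fin (n - 1) ⊕ Fin n) (Fin (n - 1) ⊕ Fin n) ℂ)
    (hAhat : Ahat = Matrix.fromBlocks 0 (Rᴴ * A) (A * R) P)
    (Bhat : Matrix (Fin (n - 1) ⊕ Fin n) (Fin (n - 1) ⊕ Fin n) ℂ)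
    (hBhat : Bhat = Matrix.fromBlocks 0 (Rᴴ * B) (B * R) 0)
    (Chat : Matrix (Fin (n - 1) ⊕ Fin n) (Fin (n - 1) ⊕ Fin n) ℂ)
    (hChat : Chat = Matrix.fromBlocks 0 (Rᴴ * C) (C * R) Q)
    (Δ₀ Δ₁ : Matrix (Fin n × (Fin (n - 1) ⊕ Fin n)) (Fin n × (Fin (n - 1) ⊕ Fin n)) ℂ)
    (hΔ₀ : Δ₀ = B ⊗ₖ Chat - C ⊗ₖ Bhat)
    (hΔ₁ : Δ₁ = A ⊗ₖ Chat - C ⊗ₖ Ahat)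
    (x : Fin (n - 1) → ℂ) (hx : x ≠ 0) (hCRx : (C * R).mulVec x = 0) :
    (fun p : Fin n × (Fin (n - 1) ⊕ Fin n) =>
        R.mulVec x p.1 * Sum.elim x (0 : Fin n → ℂ) p.2) ≠ 0 ∧
    Δ₀.mulVec (fun p => R.mulVec x p.1 * Sum.elim x (0 : Fin n → ℂ) p.2) = 0 ∧
    Δ₁.mulVec (fun p => R.mulVec x p.1 * Sum.elim x (0 : Fin n → ℂ) p.2) = 0 ∧
    ∀ lam : ℂ, (Δ₁ - lam • Δ₀).det = 0 := by
  have hCu : C.mulVec (R.mulVec x) = 0 := by rwa [mulVec_mulVec]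
  have hChatx : Chat.mulVec (Sum.elim x (0 : Fin n → ℂ)) = 0 := by
    rw [hChat, fromBlocks_mulVec]
    ext (i | i) <;> simp [hCRx]
  have hu : R.mulVec x ≠ 0 := fun h => hx (hR (h.trans (mulVec_zero R).symm))
  have hz : (fun p : Fin n × (Fin (n - 1) ⊕ Fin n) =>
      R.mulVec x p.1 * Sum.elim x (0 : Fin n → ℂ) p.2) ≠ 0 := by
    obtain ⟨i, hi⟩ := Function.ne_iff.mp hu
    obtain ⟨j, hj⟩ := Function.ne_iff.mp hx
    exact Function.ne_iff.mpr ⟨(i, Sum.inl j), mul_ne_zero hi hj⟩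
  have h₀ := kronecker_sub_kronecker_mulVec_mul_eq_zero B C Chat Bhat hCu hChatx
  have h₁ := kronecker_sub_kronecker_mulVec_mul_eq_zero A C Chat Ahat hCu hChatx
  rw [← hΔ₀] at h₀
  rw [← hΔ₁] at h₁
  refine ⟨hz, h₀, h₁, fun lam => exists_mulVec_eq_zero_iff.mp ⟨_, hz, ?_⟩⟩
  rw [sub_mulVec, smul_mulVec, h₀, h₁, smul_zero, sub_zero]
end
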